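/- Suppose the solution to the parameter-dependent boundary-value problem L(ε)y = f(·,ε), B(ε)y = c(ε) depends continuously on the parameter ε at ε = 0, i.e., conditions (∗) and (∗∗) hold. Then Limit Condition (I) holds: A_{r−j}(·,ε) → A_{r−j}(·,0) in (C^{n,α})^{m×m} as ε → 0+ for each j ∈ {1,…,r}; in particular ‖A_{r−j}(·,ε)‖_{n,α} = O(1) as ε → 0+ for each j. -/

import Mathlib

open Set Filter Topology

noncomputable section

/-- `x` belongs to the Hölder space `C^{n,α}([a,b],ℂ)`: it is `n` times continuously
differentiable on `[a,b]` and the Hölder seminorm of `x⁽ⁿ⁾` is finite. -/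
def HolMem (a b : ℝ) (n : ℕ) (α : ℝ) (x : ℝ → ℂ) : Prop :=
  ContDiffOn ℝ n x (Set.Icc a b) ∧
    ∃ C : ℝ, ∀ t₁ ∈ Set.Icc a b, ∀ t₂ ∈ Set.Icc a b, t₁ < t₂ →
      ‖iteratedDerivWithin n x (Set.Icc a b) t₂ - iteratedDerivWithin n x (Set.Icc a b) t₁‖ ≤
        C * (t₂ - t₁) ^ α

/-- The Hölder seminorm `‖x‖'_{n,α}`. -/
def holSemiNorm (a b : ℝ) (n : ℕ) (α : ℝ) (x : ℝ → ℂ) : ℝ :=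
  sSup { s : ℝ | ∃ t₁ ∈ Set.Icc a b, ∃ t₂ ∈ Set.Icc a b, t₁ < t₂ ∧
    s = ‖iteratedDerivWithin n x (Set.Icc a b) t₂ - iteratedDerivWithin n x (Set.Icc a b) t₁‖ /
        (t₂ - t₁) ^ α }

/-- The Hölder norm `‖x‖_{n,α} = ∑_{j=0}^n max_{[a,b]} |x⁽ʲ⁾| + ‖x‖'_{n,α}`. -/
def holNorm (a b : ℝ) (n : ℕ) (α : ℝ) (x : ℝ → ℂ) : ℝ :=
  (∑ j ∈ Finset.range (n + 1),
      sSup { s : ℝ | ∃ t ∈ Set.Icc a b, s = ‖iteratedDerivWithin j x (Set.Icc a b) t‖ }) +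
    holSemiNorm a b n α x

/-- Vector-valued Hölder class `(C^{n,α})^k`. -/
def vHolMem (a b : ℝ) (n : ℕ) (α : ℝ) {k : ℕ} (x : ℝ → (Fin k → ℂ)) : Prop :=
  ∀ i, HolMem a b n α (fun t => x t i)

/-- Norm on `(C^{n,α})^k`: the sum of the norms of the entries. -/
def vHolNorm (a b : ℝ) (n : ℕ) (α : ℝ) {k : ℕ} (x : ℝ → (Fin k → ℂ)) : ℝ :=
  ∑ i, holNorm a b n α (fun t => x t i)

/-- Matrix-valued Hölder class `(C^{n,α})^{k×l}`. -/
def mHolMem (a b : ℝ) (n : ℕ) (α : ℝ) {k l : ℕ} (X : ℝ → Matrix (Fin k) (Fin l) ℂ) : Prop :=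
  ∀ i j, HolMem a b n α (fun t => X t i j)

/-- Norm on `(C^{n,α})^{k×l}`: the sum of the norms of the entries. -/
def mHolNorm (a b : ℝ) (n : ℕ) (α : ℝ) {k l : ℕ} (X : ℝ → Matrix (Fin k) (Fin l) ℂ) : ℝ :=
  ∑ i, ∑ j, holNorm a b n α (fun t => X t i j)

/-- Entrywise `p`-th derivative of a vector-valued function on `[a,b]`. -/
def vDeriv (a b : ℝ) (p : ℕ) {k : ℕ} (y : ℝ → (Fin k → ℂ)) : ℝ → (Fin k → ℂ) :=
  fun t i => iteratedDerivWithin p (fun s => y s i) (Set.Icc a b) t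

/-- Entrywise `p`-th derivative of a matrix-valued function on `[a,b]`. -/
def mDeriv (a b : ℝ) (p : ℕ) {k l : ℕ} (Y : ℝ → Matrix (Fin k) (Fin l) ℂ) :
    ℝ → Matrix (Fin k) (Fin l) ℂ :=
  fun t i j => iteratedDerivWithin p (fun s => Y s i j) (Set.Icc a b) t

/-- The differential expression `(L y)(t) = y⁽ʳ⁾(t) + ∑_{j=1}^r A_{r-j}(t) y⁽ʳ⁻ʲ⁾(t)`;
here `A j` denotes the coefficient matrix of `y⁽ʲ⁾`, for `0 ≤ j ≤ r-1`. -/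
def Lop (a b : ℝ) (r : ℕ) {m : ℕ} (A : Fin r → ℝ → Matrix (Fin m) (Fin m) ℂ)
    (y : ℝ → (Fin m → ℂ)) : ℝ → (Fin m → ℂ) :=
  fun t => vDeriv a b r y t + ∑ j : Fin r, (A j t).mulVec (vDeriv a b (j : ℕ) y t)

/-- The matrix analogue of `Lop`, applied to matrix-valued functions. -/
def LopM (a b : ℝ) (r : ℕ) {m k : ℕ} (A : Fin r → ℝ → Matrix (Fin m) (Fin m) ℂ)
    (Z : ℝ → Matrix (Fin m) (Fin k) ℂ) : ℝ → Matrix (Fin m) (Fin k) ℂ :=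
  fun t => mDeriv a b r Z t + ∑ j : Fin r, A j t * mDeriv a b (j : ℕ) Z t

/-- `y` is a solution in `(C^{n+r,α})^m` of the problem `L y = f` on `[a,b]`, `B y = c`. -/
def IsSol (a b : ℝ) (n : ℕ) (α : ℝ) (r m : ℕ)
    (A : Fin r → ℝ → Matrix (Fin m) (Fin m) ℂ)
    (B : (ℝ → (Fin m → ℂ)) →ₗ[ℂ] (Fin (r * m) → ℂ))
    (f : ℝ → (Fin m → ℂ)) (c : Fin (r * m) → ℂ) (y : ℝ → (Fin m → ℂ)) : Prop :=
  vHolMem a b (n + r) α y ∧ (∀ t ∈ Set.Icc a b, Lop a b r A y t = f t) ∧ B y = c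

/-- Limit Condition (I): `A_{r-j}(·,ε) → A_{r-j}(·,0)` in `(C^{n,α})^{m×m}` as `ε → 0+`. -/
def CondI (a b : ℝ) (n : ℕ) (α : ℝ) (r m : ℕ)
    (A : ℝ → Fin r → ℝ → Matrix (Fin m) (Fin m) ℂ) : Prop :=
  ∀ j : Fin r,
    Tendsto (fun ε => mHolNorm a b n α (fun t => A ε j t - A 0 j t))
      (nhdsWithin 0 (Set.Ioi 0)) (nhds 0)

/-- Limit Condition (II): `B(ε)y → B(0)y` in `ℂ^{rm}` as `ε → 0+`,
for every `y ∈ (C^{n+r,α})^m`. -/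
def CondII (a b : ℝ) (n : ℕ) (α : ℝ) (r m : ℕ)
    (B : ℝ → (ℝ → (Fin m → ℂ)) →ₗ[ℂ] (Fin (r * m) → ℂ)) : Prop :=
  ∀ y : ℝ → (Fin m → ℂ), vHolMem a b (n + r) α y →
    Tendsto (fun ε => B ε y) (nhdsWithin 0 (Set.Ioi 0)) (nhds (B 0 y))

/-- Condition (0): the homogeneous problem `L(0)y = 0`, `B(0)y = 0` has only the
trivial solution in `(C^{n+r,α})^m`. -/
def Cond0 (a b : ℝ) (n : ℕ) (α : ℝ) (r m : ℕ)
    (A : Fin r → ℝ → Matrix (Fin m) (Fin m) ℂ)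
    (B : (ℝ → (Fin m → ℂ)) →ₗ[ℂ] (Fin (r * m) → ℂ)) : Prop :=
  ∀ y : ℝ → (Fin m → ℂ), vHolMem a b (n + r) α y →
    (∀ t ∈ Set.Icc a b, Lop a b r A y t = 0) → B y = 0 →
    ∀ t ∈ Set.Icc a b, y t = 0

/-- Condition (∗): for every `ε ∈ [0,ε₁)` and arbitrary data `f ∈ (C^{n,α})^m`, `c ∈ ℂ^{rm}`,
the problem `L(ε)y = f`, `B(ε)y = c` has a unique solution `y ∈ (C^{n+r,α})^m`
(uniqueness is understood as equality on `[a,b]`). -/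
def CondStar (a b : ℝ) (n : ℕ) (α : ℝ) (r m : ℕ) (ε₁ : ℝ)
    (A : ℝ → Fin r → ℝ → Matrix (Fin m) (Fin m) ℂ)
    (B : ℝ → (ℝ → (Fin m → ℂ)) →ₗ[ℂ] (Fin (r * m) → ℂ)) : Prop :=
  ∀ ε ∈ Set.Ico (0 : ℝ) ε₁, ∀ f : ℝ → (Fin m → ℂ), vHolMem a b n α f →
    ∀ c : Fin (r * m) → ℂ,
      ∃ y, IsSol a b n α r m (A ε) (B ε) f c y ∧
        ∀ y', IsSol a b n α r m (A ε) (B ε) f c y' → Set.EqOn y' y (Set.Icc a b)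

/-- Condition (∗∗): if `f(·,ε) → f(·,0)` in `(C^{n,α})^m` and `c(ε) → c(0)` in `ℂ^{rm}`
as `ε → 0+`, then the solutions satisfy `y(·,ε) → y(·,0)` in `(C^{n+r,α})^m`. -/
def CondStarStar (a b : ℝ) (n : ℕ) (α : ℝ) (r m : ℕ) (ε₁ : ℝ)
    (A : ℝ → Fin r → ℝ → Matrix (Fin m) (Fin m) ℂ)
    (B : ℝ → (ℝ → (Fin m → ℂ)) →ₗ[ℂ] (Fin (r * m) → ℂ)) : Prop :=
  ∀ (f : ℝ → ℝ → (Fin m → ℂ)) (c : ℝ → Fin (r * m) → ℂ) (y : ℝ → ℝ → (Fin m → ℂ)),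
    (∀ ε ∈ Set.Ico (0 : ℝ) ε₁, vHolMem a b n α (f ε) ∧
      IsSol a b n α r m (A ε) (B ε) (f ε) (c ε) (y ε)) →
    Tendsto (fun ε => vHolNorm a b n α (fun t => f ε t - f 0 t))
      (nhdsWithin 0 (Set.Ioi 0)) (nhds 0) →
    Tendsto c (nhdsWithin 0 (Set.Ioi 0)) (nhds (c 0)) →
    Tendsto (fun ε => vHolNorm a b (n + r) α (fun t => y ε t - y 0 t))
      (nhdsWithin 0 (Set.Ioi 0)) (nhds 0)


/-- Quantitative Hölder control: all derivatives up to order `n` are bounded by `M` and are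
`α`-Hölder with constant `M`. -/
structure Gd (a b : ℝ) (n : ℕ) (α : ℝ) (x : ℝ → ℂ) (M : ℝ) : Prop where
  nonneg : 0 ≤ M
  cd : ContDiffOn ℝ n x (Icc a b)
  bd : ∀ j ≤ n, ∀ t ∈ Icc a b, ‖iteratedDerivWithin j x (Icc a b) t‖ ≤ M
  hol : ∀ j ≤ n, ∀ t₁ ∈ Icc a b, ∀ t₂ ∈ Icc a b, t₁ < t₂ →
    ‖iteratedDerivWithin j x (Icc a b) t₂ - iteratedDerivWithin j x (Icc a b) t₁‖ ≤
      M * (t₂ - t₁) ^ α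

lemma holNorm_nonneg' (a b : ℝ) (n : ℕ) (α : ℝ) (x : ℝ → ℂ) : 0 ≤ holNorm a b n α x := by
  unfold holNorm holSemiNorm
  refine add_nonneg (Finset.sum_nonneg fun j _ => Real.sSup_nonneg ?_) (Real.sSup_nonneg ?_)
  · rintro s ⟨t, _, rfl⟩; positivity
  · rintro s ⟨t₁, _, t₂, _, h, rfl⟩
    have : 0 < t₂ - t₁ := by linarith
    positivity

lemma Gd.holMem {a b : ℝ} {n : ℕ} {α : ℝ} {x : ℝ → ℂ} {M : ℝ} (h : Gd a b n α x M) :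
    HolMem a b n α x := ⟨h.cd, M, h.hol n le_rfl⟩

lemma Gd.holNorm_le {a b : ℝ} {n : ℕ} {α : ℝ} {x : ℝ → ℂ} {M : ℝ} (h : Gd a b n α x M) :
    holNorm a b n α x ≤ (n + 2) * M := by
  have h1 : ∀ j ∈ Finset.range (n + 1),
      sSup { s : ℝ | ∃ t ∈ Set.Icc a b, s = ‖iteratedDerivWithin j x (Set.Icc a b) t‖ } ≤ M := by
    intro j hj
    refine Real.sSup_le ?_ h.nonneg
    rintro s ⟨t, ht, rfl⟩
    exact h.bd j (by simpa [Nat.lt_succ_iff] using hj) t ht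
  have h2 : holSemiNorm a b n α x ≤ M := by
    refine Real.sSup_le ?_ h.nonneg
    rintro s ⟨t₁, h1, t₂, h2, hlt, rfl⟩
    have : 0 < t₂ - t₁ := by linarith
    rw [div_le_iff₀ (by positivity)]
    exact h.hol n le_rfl t₁ h1 t₂ h2 hlt
  have h3 := Finset.sum_le_sum h1
  simp only [Finset.sum_const, Finset.card_range, nsmul_eq_mul] at h3
  push_cast at h3
  unfold holNorm
  linarith

lemma lip_to_hol {a b α : ℝ} (hα1 : α ≤ 1) {M : ℝ} (hM : 0 ≤ M)
    {t₁ t₂ : ℝ} (h1 : t₁ ∈ Icc a b) (h2 : t₂ ∈ Icc a b) (h : t₁ < t₂) :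
    M * (t₂ - t₁) ≤ M * (b - a) ^ (1 - α) * (t₂ - t₁) ^ α := by
  have hp : 0 < t₂ - t₁ := by linarith
  have : t₂ - t₁ = (t₂ - t₁) ^ (1 - α) * (t₂ - t₁) ^ α := by
    rw [← Real.rpow_add hp]; simp
  have h3 : (t₂ - t₁) ^ (1 - α) ≤ (b - a) ^ (1 - α) :=
    Real.rpow_le_rpow hp.le (by linarith [h1.1, h2.2]) (by linarith)
  rw [mul_assoc]
  refine mul_le_mul_of_nonneg_left ?_ hM
  conv_lhs => rw [this]
  gcongr

lemma deriv_lip {a b : ℝ} (hab : a < b) {n : ℕ} {x : ℝ → ℂ} (hx : ContDiffOn ℝ n x (Icc a b))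
    {j : ℕ} (hj : j < n) {M : ℝ}
    (hM : ∀ t ∈ Icc a b, ‖iteratedDerivWithin (j + 1) x (Icc a b) t‖ ≤ M)
    {t₁ t₂ : ℝ} (h1 : t₁ ∈ Icc a b) (h2 : t₂ ∈ Icc a b) (h : t₁ < t₂) :
    ‖iteratedDerivWithin j x (Icc a b) t₂ - iteratedDerivWithin j x (Icc a b) t₁‖ ≤
      M * (t₂ - t₁) := by
  have hd := hx.differentiableOn_iteratedDerivWithin (m := j) (by exact_mod_cast hj)
    (uniqueDiffOn_Icc hab)
  have := Convex.norm_image_sub_le_of_norm_derivWithin_le hd (C := M)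
    (by intro t ht; rw [← iteratedDerivWithin_succ]; exact hM t ht) (convex_Icc a b) h1 h2
  rwa [Real.norm_of_nonneg (by linarith)] at this

lemma deriv_bdd {a b : ℝ} (hab : a < b) {n : ℕ} {x : ℝ → ℂ} (hx : ContDiffOn ℝ n x (Icc a b))
    {j : ℕ} (hj : j ≤ n) :
    BddAbove { s : ℝ | ∃ t ∈ Set.Icc a b, s = ‖iteratedDerivWithin j x (Set.Icc a b) t‖ } := by
  have hc := (hx.continuousOn_iteratedDerivWithin (m := j) (by exact_mod_cast hj)
    (uniqueDiffOn_Icc hab)).norm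
  obtain ⟨C, hC⟩ := isCompact_Icc.bddAbove_image hc
  refine ⟨C, ?_⟩
  rintro s ⟨t, ht, rfl⟩
  exact hC ⟨t, ht, rfl⟩

/-- The constant comparing the Hölder norm with `Gd`. -/
def KK (a b α : ℝ) : ℝ := 1 + (b - a) ^ (1 - α)

lemma KK_pos {a b α : ℝ} (hab : a < b) : 1 ≤ KK a b α := by
  have : 0 < b - a := by linarith
  have := Real.rpow_pos_of_pos this (1 - α)
  unfold KK; linarith

lemma HolMem.gd {a b : ℝ} (hab : a < b) {n : ℕ} {α : ℝ} (hα1 : α ≤ 1)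
    {x : ℝ → ℂ} (h : HolMem a b n α x) : Gd a b n α x (KK a b α * holNorm a b n α x) := by
  have hK := KK_pos (α := α) hab
  have hN := holNorm_nonneg' a b n α x
  have hba : 0 < (b - a) ^ (1 - α) := Real.rpow_pos_of_pos (by linarith) _
  have hs0 : 0 ≤ holSemiNorm a b n α x := by
    refine Real.sSup_nonneg ?_
    rintro s ⟨t₁, _, t₂, _, h, rfl⟩
    have : 0 < t₂ - t₁ := by linarith
    positivity
  have hS : ∀ j ≤ n, sSup { s : ℝ | ∃ t ∈ Set.Icc a b,
      s = ‖iteratedDerivWithin j x (Set.Icc a b) t‖ } ≤ holNorm a b n α x := by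
    intro j hj
    have := Finset.single_le_sum (s := Finset.range (n + 1)) (f := fun j =>
      sSup { s : ℝ | ∃ t ∈ Set.Icc a b, s = ‖iteratedDerivWithin j x (Set.Icc a b) t‖ })
      (fun i _ => Real.sSup_nonneg (by rintro s ⟨t, _, rfl⟩; positivity))
      (Finset.mem_range.2 (Nat.lt_succ_of_le hj))
    unfold holNorm
    linarith
  have hb : ∀ j ≤ n, ∀ t ∈ Icc a b, ‖iteratedDerivWithin j x (Icc a b) t‖ ≤
      holNorm a b n α x := fun j hj t ht =>
    (le_csSup (deriv_bdd hab h.1 hj) ⟨t, ht, rfl⟩).trans (hS j hj)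
  have hle : holNorm a b n α x ≤ KK a b α * holNorm a b n α x := by nlinarith
  refine ⟨by positivity, h.1, fun j hj t ht => (hb j hj t ht).trans hle, ?_⟩
  intro j hj t₁ h1 t₂ h2 hlt
  have hp : 0 < t₂ - t₁ := by linarith
  have hpa : 0 < (t₂ - t₁) ^ α := Real.rpow_pos_of_pos hp _
  rcases hj.lt_or_eq with hj' | rfl
  · refine (deriv_lip hab h.1 hj' (hb (j + 1) hj') h1 h2 hlt).trans
      ((lip_to_hol hα1 hN h1 h2 hlt).trans ?_)
    refine mul_le_mul_of_nonneg_right ?_ hpa.le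
    unfold KK; nlinarith
  · have : BddAbove { s : ℝ | ∃ t₁ ∈ Set.Icc a b, ∃ t₂ ∈ Set.Icc a b, t₁ < t₂ ∧
      s = ‖iteratedDerivWithin j x (Set.Icc a b) t₂ - iteratedDerivWithin j x (Set.Icc a b) t₁‖ /
        (t₂ - t₁) ^ α } := by
      obtain ⟨C, hC⟩ := h.2
      refine ⟨C, ?_⟩
      rintro s ⟨t₁, h1, t₂, h2, hlt, rfl⟩
      have : 0 < t₂ - t₁ := by linarith
      rw [div_le_iff₀ (by positivity)]
      exact hC t₁ h1 t₂ h2 hlt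
    have h3 := le_csSup this ⟨t₁, h1, t₂, h2, hlt, rfl⟩
    rw [div_le_iff₀ hpa] at h3
    refine h3.trans (mul_le_mul_of_nonneg_right ?_ hpa.le)
    refine le_trans ?_ hle
    unfold holNorm
    have : 0 ≤ ∑ j_1 ∈ Finset.range (j + 1),
      sSup { s : ℝ | ∃ t ∈ Set.Icc a b, s = ‖iteratedDerivWithin j_1 x (Set.Icc a b) t‖ } :=
      Finset.sum_nonneg fun i _ => Real.sSup_nonneg (by rintro s ⟨t, _, rfl⟩; positivity)
    unfold holSemiNorm
    linarith

lemma smooth_gd {a b : ℝ} (hab : a < b) (n : ℕ) {α : ℝ} (hα1 : α ≤ 1)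
    {x : ℝ → ℂ} (h : ContDiffOn ℝ (n + 1 : ℕ) x (Icc a b)) : ∃ M, Gd a b n α x M := by
  have h' : ContDiffOn ℝ n x (Icc a b) := h.of_le (by exact_mod_cast Nat.le_succ n)
  obtain ⟨C, hC⟩ := deriv_bdd hab h (le_refl (n + 1))
  have hb : ∀ t ∈ Icc a b, ‖iteratedDerivWithin (n + 1) x (Icc a b) t‖ ≤ C :=
    fun t ht => hC ⟨t, ht, rfl⟩
  have hC0 : 0 ≤ C := (norm_nonneg _).trans (hb a ⟨le_rfl, hab.le⟩)
  refine ⟨_, HolMem.gd hab hα1 ⟨h', C * (b - a) ^ (1 - α), ?_⟩⟩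
  intro t₁ h1 t₂ h2 hlt
  exact (deriv_lip hab h (Nat.lt_succ_self n) hb h1 h2 hlt).trans
      (lip_to_hol hα1 hC0 h1 h2 hlt)

lemma Gd.mono {a b : ℝ} {n : ℕ} {α : ℝ} {x : ℝ → ℂ} {M M' : ℝ} (h : Gd a b n α x M)
    (hM : M ≤ M') : Gd a b n α x M' := by
  refine ⟨h.nonneg.trans hM, h.cd, fun j hj t ht => (h.bd j hj t ht).trans hM, ?_⟩
  intro j hj t₁ h1 t₂ h2 hlt
  have hp : 0 < t₂ - t₁ := by linarith
  exact (h.hol j hj t₁ h1 t₂ h2 hlt).trans (mul_le_mul_of_nonneg_right hM (by positivity))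

lemma Gd.congr {a b : ℝ} {n : ℕ} {α : ℝ} {x y : ℝ → ℂ} {M : ℝ} (h : Gd a b n α x M)
    (hxy : ∀ t ∈ Icc a b, y t = x t) : Gd a b n α y M := by
  have e : ∀ j, ∀ t ∈ Icc a b, iteratedDerivWithin j y (Icc a b) t =
      iteratedDerivWithin j x (Icc a b) t := fun j t ht =>
    iteratedDerivWithin_congr (n := j) (s := Icc a b) (f := y) (g := x) hxy ht
  refine ⟨h.nonneg, h.cd.congr hxy, fun j hj t ht => ?_, ?_⟩
  · rw [e j t ht]; exact h.bd j hj t ht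
  · intro j hj t₁ h1 t₂ h2 hlt
    rw [e j _ h1, e j _ h2]; exact h.hol j hj t₁ h1 t₂ h2 hlt

lemma Gd.add {a b : ℝ} (hab : a < b) {n : ℕ} {α : ℝ} {x y : ℝ → ℂ} {M N : ℝ}
    (hx : Gd a b n α x M) (hy : Gd a b n α y N) :
    Gd a b n α (fun t => x t + y t) (M + N) := by
  have e : ∀ j ≤ n, ∀ t ∈ Icc a b, iteratedDerivWithin j (fun t => x t + y t) (Icc a b) t =
      iteratedDerivWithin j x (Icc a b) t + iteratedDerivWithin j y (Icc a b) t := by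
    intro j hj t ht
    have hj' : (j : WithTop ℕ∞) ≤ n := by exact_mod_cast hj
    exact iteratedDerivWithin_add ht (uniqueDiffOn_Icc hab)
      ((hx.cd t ht).of_le hj') ((hy.cd t ht).of_le hj')
  refine ⟨add_nonneg hx.nonneg hy.nonneg, hx.cd.add hy.cd, fun j hj t ht => ?_, ?_⟩
  · rw [e j hj t ht]
    exact (norm_add_le _ _).trans (add_le_add (hx.bd j hj t ht) (hy.bd j hj t ht))
  · intro j hj t₁ h1 t₂ h2 hlt
    rw [e j hj _ h1, e j hj _ h2, add_sub_add_comm, add_mul]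
    exact (norm_add_le _ _).trans (add_le_add (hx.hol j hj _ h1 _ h2 hlt)
      (hy.hol j hj _ h1 _ h2 hlt))

lemma Gd.mul {a b : ℝ} (hab : a < b) {n : ℕ} {α : ℝ} {x y : ℝ → ℂ} {M N : ℝ}
    (hx : Gd a b n α x M) (hy : Gd a b n α y N) :
    Gd a b n α (fun t => x t * y t) (2 ^ (n + 1) * M * N) := by
  have hM := hx.nonneg
  have hN := hy.nonneg
  have e : ∀ j ≤ n, ∀ t ∈ Icc a b, iteratedDerivWithin j (fun t => x t * y t) (Icc a b) t =
      ∑ i ∈ Finset.range (j + 1), j.choose i * iteratedDerivWithin i x (Icc a b) t *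
        iteratedDerivWithin (j - i) y (Icc a b) t := by
    intro j hj t ht
    have hj' : (j : WithTop ℕ∞) ≤ n := by exact_mod_cast hj
    exact iteratedDerivWithin_mul ht (uniqueDiffOn_Icc hab)
      ((hx.cd t ht).of_le hj') ((hy.cd t ht).of_le hj')
  have hch : ∀ j ≤ n, ∀ Q : ℝ, 0 ≤ Q →
      ∑ i ∈ Finset.range (j + 1), (j.choose i : ℝ) * Q ≤ 2 ^ n * Q := by
    intro j hj Q hQ
    rw [← Finset.sum_mul]
    refine mul_le_mul_of_nonneg_right ?_ hQ
    have := Nat.sum_range_choose j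
    rw [← Nat.cast_sum, this]; push_cast
    exact pow_le_pow_right₀ (by norm_num) hj
  refine ⟨by positivity, hx.cd.mul hy.cd, fun j hj t ht => ?_, ?_⟩
  · rw [e j hj t ht]
    have h1 : ‖∑ i ∈ Finset.range (j + 1), (j.choose i : ℂ) * iteratedDerivWithin i x (Icc a b) t *
        iteratedDerivWithin (j - i) y (Icc a b) t‖ ≤
        ∑ i ∈ Finset.range (j + 1), (j.choose i : ℝ) * (M * N) := by
      refine (norm_sum_le _ _).trans (Finset.sum_le_sum fun i hi => ?_)
      have hi' : i ≤ j := by simpa [Nat.lt_succ_iff] using hi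
      rw [norm_mul, norm_mul, mul_assoc, Complex.norm_natCast]
      have := hx.bd i (hi'.trans hj) t ht
      have := hy.bd (j - i) (by omega) t ht
      gcongr
    refine h1.trans ((hch j hj _ (by positivity)).trans ?_)
    have : 0 ≤ 2 ^ n * (M * N) := by positivity
    rw [pow_succ]; nlinarith
  · intro j hj t₁ h1 t₂ h2 hlt
    have hp : 0 < t₂ - t₁ := by linarith
    have hpa : 0 < (t₂ - t₁) ^ α := Real.rpow_pos_of_pos hp _
    rw [e j hj _ h1, e j hj _ h2, ← Finset.sum_sub_distrib]
    have h3 : ‖∑ i ∈ Finset.range (j + 1),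
        ((j.choose i : ℂ) * iteratedDerivWithin i x (Icc a b) t₂ *
          iteratedDerivWithin (j - i) y (Icc a b) t₂ -
        (j.choose i : ℂ) * iteratedDerivWithin i x (Icc a b) t₁ *
          iteratedDerivWithin (j - i) y (Icc a b) t₁)‖ ≤
        ∑ i ∈ Finset.range (j + 1), (j.choose i : ℝ) * (2 * M * N * (t₂ - t₁) ^ α) := by
      refine (norm_sum_le _ _).trans (Finset.sum_le_sum fun i hi => ?_)
      have hi' : i ≤ j := by simpa [Nat.lt_succ_iff] using hi
      rw [mul_assoc, mul_assoc, ← mul_sub, norm_mul, Complex.norm_natCast]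
      refine mul_le_mul_of_nonneg_left ?_ (by positivity)
      have b1 := hx.bd i (hi'.trans hj) _ h1
      have b2 := hy.bd (j - i) (by omega) _ h2
      have c1 := hx.hol i (hi'.trans hj) _ h1 _ h2 hlt
      have c2 := hy.hol (j - i) (by omega) _ h1 _ h2 hlt
      generalize iteratedDerivWithin i x (Icc a b) t₁ = x1 at *
      generalize iteratedDerivWithin i x (Icc a b) t₂ = x2 at *
      generalize iteratedDerivWithin (j - i) y (Icc a b) t₁ = y1 at *
      generalize iteratedDerivWithin (j - i) y (Icc a b) t₂ = y2 at *
      have : x2 * y2 - x1 * y1 = (x2 - x1) * y2 + x1 * (y2 - y1) := by ring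
      rw [this]
      calc _ ≤ ‖x2 - x1‖ * ‖y2‖ + ‖x1‖ * ‖y2 - y1‖ := by
            refine (norm_add_le _ _).trans ?_
            rw [norm_mul, norm_mul]
        _ ≤ (M * (t₂ - t₁) ^ α) * N + M * (N * (t₂ - t₁) ^ α) := by gcongr
        _ = _ := by ring
    refine h3.trans ((hch j hj _ (by positivity)).trans (le_of_eq ?_))
    ring

lemma Gd.zero (a b : ℝ) (n : ℕ) (α : ℝ) : Gd a b n α (fun _ => 0) 0 := by
  refine ⟨le_rfl, contDiffOn_const, fun j hj t ht => ?_, ?_⟩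
  · simp
  · intro j hj t₁ h1 t₂ h2 hlt
    simp

lemma Gd.smul {a b : ℝ} {n : ℕ} {α : ℝ} {x : ℝ → ℂ} {M : ℝ} (c : ℂ)
    (hx : Gd a b n α x M) :
    Gd a b n α (fun t => c * x t) (‖c‖ * M) := by
  have e : ∀ j, ∀ t, iteratedDerivWithin j (fun t => c * x t) (Icc a b) t =
      c * iteratedDerivWithin j x (Icc a b) t := fun j t =>
    iteratedDerivWithin_const_mul_field c x
  refine ⟨mul_nonneg (norm_nonneg _) hx.nonneg, contDiffOn_const.mul hx.cd,
    fun j hj t ht => ?_, ?_⟩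
  · rw [e, norm_mul]
    exact mul_le_mul_of_nonneg_left (hx.bd j hj t ht) (norm_nonneg _)
  · intro j hj t₁ h1 t₂ h2 hlt
    rw [e, e, ← mul_sub, norm_mul, mul_assoc]
    exact mul_le_mul_of_nonneg_left (hx.hol j hj _ h1 _ h2 hlt) (norm_nonneg _)

lemma Gd.sum {a b : ℝ} (hab : a < b) {n : ℕ} {α : ℝ} {ι : Type*} (s : Finset ι)
    {x : ι → ℝ → ℂ} {M : ι → ℝ} (hx : ∀ i ∈ s, Gd a b n α (x i) (M i)) :
    Gd a b n α (fun t => ∑ i ∈ s, x i t) (∑ i ∈ s, M i) := by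
  classical
  induction s using Finset.induction_on with
  | empty => simpa using Gd.zero a b n α
  | insert i s hi ih =>
    rw [Finset.sum_insert hi]
    simp only [Finset.sum_insert hi]
    exact (hx i (by simp)).add hab (ih fun k hk => hx k (by simp [hk]))

lemma iterW_add (s : Set ℝ) (x : ℝ → ℂ) (i j : ℕ) :
    iteratedDerivWithin i (iteratedDerivWithin j x s) s = iteratedDerivWithin (i + j) x s := by
  induction i with
  | zero => simp
  | succ i ih => rw [iteratedDerivWithin_succ, ih, Nat.succ_add_eq_add_succ,
      ← iteratedDerivWithin_succ]; rfl

lemma Gd.deriv {a b : ℝ} (hab : a < b) {n r : ℕ} {α : ℝ} {x : ℝ → ℂ} {M : ℝ}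
    (hx : Gd a b (n + r) α x M) {j : ℕ} (hj : j ≤ r) :
    Gd a b n α (iteratedDerivWithin j x (Icc a b)) M := by
  have hu := uniqueDiffOn_Icc hab
  refine ⟨hx.nonneg, ?_, fun i hi t ht => ?_, ?_⟩
  · rw [contDiffOn_nat_iff_continuousOn_differentiableOn_deriv hu]
    have := (contDiffOn_nat_iff_continuousOn_differentiableOn_deriv hu).1 hx.cd
    refine ⟨fun i hi => ?_, fun i hi => ?_⟩
    · rw [iterW_add]; exact this.1 _ (by omega)
    · rw [iterW_add]; exact this.2 _ (by omega)
  · rw [iterW_add]; exact hx.bd _ (by omega) t ht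
  · intro i hi t₁ h1 t₂ h2 hlt
    rw [iterW_add]; exact hx.hol _ (by omega) _ h1 _ h2 hlt

lemma exp_cd (l : ℂ) (n : WithTop ℕ∞) : ContDiff ℝ n (fun t : ℝ => Complex.exp (l * t)) := by
  have : ContDiff ℝ n (fun t : ℝ => (t : ℂ)) := Complex.ofRealCLM.contDiff
  exact (contDiff_const.mul this).cexp

lemma exp_deriv {a b : ℝ} (hab : a < b) (l : ℂ) (j : ℕ) : ∀ t ∈ Icc a b,
    iteratedDerivWithin j (fun t : ℝ => Complex.exp (l * t)) (Icc a b) t =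
      l ^ j * Complex.exp (l * t) := by
  induction j with
  | zero => simp
  | succ j ih =>
    intro t ht
    rw [iteratedDerivWithin_succ, derivWithin_congr ih (ih t ht)]
    have h1 : HasDerivAt (fun t : ℝ => (t : ℂ)) 1 t := Complex.ofRealCLM.hasDerivAt
    have h2 := (((h1.const_mul l).cexp).const_mul (l ^ j)).hasDerivWithinAt (s := Icc a b)
    rw [h2.derivWithin (uniqueDiffOn_Icc hab t ht)]
    ring

/-- Test functions `e^{kt} e_i`. -/
def yTest (r m : ℕ) (k : Fin r) (i : Fin m) : ℝ → (Fin m → ℂ) :=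
  fun t p => (if p = i then (1 : ℂ) else 0) * Complex.exp (((k : ℕ) : ℂ) * t)

lemma yTest_cd (r m : ℕ) (k : Fin r) (i p : Fin m) (n : WithTop ℕ∞) :
    ContDiff ℝ n (fun t => yTest r m k i t p) :=
  contDiff_const.mul (exp_cd _ n)

lemma yTest_deriv {a b : ℝ} (hab : a < b) (r m : ℕ) (k : Fin r) (i p : Fin m) (j : ℕ) :
    ∀ t ∈ Icc a b, iteratedDerivWithin j (fun t => yTest r m k i t p) (Icc a b) t =
      (if p = i then (1 : ℂ) else 0) * (((k : ℕ) : ℂ) ^ j * Complex.exp (((k : ℕ) : ℂ) * t)) := by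
  intro t ht
  rw [← exp_deriv hab _ j t ht]
  exact iteratedDerivWithin_const_mul_field _ _

lemma Lop_apply (a b : ℝ) (r : ℕ) {m : ℕ} (A : Fin r → ℝ → Matrix (Fin m) (Fin m) ℂ)
    (y : ℝ → (Fin m → ℂ)) (t : ℝ) (p : Fin m) :
    Lop a b r A y t p = iteratedDerivWithin r (fun s => y s p) (Icc a b) t +
      ∑ j : Fin r, ∑ q, A j t p q * iteratedDerivWithin (j : ℕ) (fun s => y s q) (Icc a b) t := by
  simp [Lop, vDeriv, Matrix.mulVec, dotProduct]

lemma key_identity {a b : ℝ} (hab : a < b) (n : ℕ) (m r : ℕ)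
    (A0 A1 : Fin r → ℝ → Matrix (Fin m) (Fin m) ℂ) (k : Fin r) (i p : Fin m)
    (y : ℝ → (Fin m → ℂ))
    (hE : ∀ q, ContDiffOn ℝ (n + r : ℕ) (fun t => y t q - yTest r m k i t q) (Icc a b))
    (t : ℝ) (ht : t ∈ Icc a b)
    (heq : Lop a b r A1 y t = Lop a b r A0 (yTest r m k i) t) :
    ∑ j : Fin r, (((k : ℕ) : ℂ) ^ (j : ℕ) * Complex.exp (((k : ℕ) : ℂ) * t)) *
        (A1 j t p i - A0 j t p i) =
      (-1) * iteratedDerivWithin r (fun t => y t p - yTest r m k i t p) (Icc a b) t +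
      ((-1) * (∑ j : Fin r, ∑ q, A0 j t p q *
        iteratedDerivWithin j (fun t => y t q - yTest r m k i t q) (Icc a b) t) +
      (-1) * (∑ j : Fin r, ∑ q, (A1 j t p q - A0 j t p q) *
        iteratedDerivWithin j (fun t => y t q - yTest r m k i t q) (Icc a b) t)) := by
  have hd : ∀ j ≤ r, ∀ q, iteratedDerivWithin j (fun s => y s q) (Icc a b) t =
      iteratedDerivWithin j (fun t => y t q - yTest r m k i t q) (Icc a b) t +
      iteratedDerivWithin j (fun t => yTest r m k i t q) (Icc a b) t := by
    intro j hj q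
    have hj' : (j : WithTop ℕ∞) ≤ (n + r : ℕ) := by exact_mod_cast (by omega : j ≤ n + r)
    have := iteratedDerivWithin_add (n := j) ht (uniqueDiffOn_Icc hab)
      ((hE q t ht).of_le hj') (yTest_cd r m k i q j).contDiffWithinAt
    rw [← this]
    congr 1
    funext s
    simp
  have h := congrFun heq p
  rw [Lop_apply, Lop_apply, hd r le_rfl p] at h
  have h2 : ∀ j : Fin r, ∀ q, iteratedDerivWithin (j : ℕ) (fun s => y s q) (Icc a b) t =
      iteratedDerivWithin j (fun t => y t q - yTest r m k i t q) (Icc a b) t +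
      iteratedDerivWithin j (fun t => yTest r m k i t q) (Icc a b) t :=
    fun j q => hd j j.2.le q
  have h3 : ∑ j : Fin r, (((k : ℕ) : ℂ) ^ (j : ℕ) * Complex.exp (((k : ℕ) : ℂ) * t)) *
        (A1 j t p i - A0 j t p i) = ∑ j : Fin r, ∑ q, (A1 j t p q - A0 j t p q) *
        iteratedDerivWithin j (fun t => yTest r m k i t q) (Icc a b) t := by
    refine Finset.sum_congr rfl fun j _ => ?_
    simp_rw [yTest_deriv hab r m k i _ j t ht]
    simp [mul_comm]
  rw [h3]
  simp_rw [h2, mul_add, Finset.sum_add_distrib] at h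
  simp_rw [sub_mul, Finset.sum_sub_distrib]
  linear_combination h

lemma exists_common {ι : Type*} [Fintype ι] {a b : ℝ} {n : ℕ} {α : ℝ} (x : ι → ℝ → ℂ)
    (h : ∀ i, ∃ M, Gd a b n α (x i) M) : ∃ M, 0 ≤ M ∧ ∀ i, Gd a b n α (x i) M := by
  choose M hM using h
  refine ⟨∑ i, M i, Finset.sum_nonneg fun i _ => (hM i).nonneg, fun i => (hM i).mono ?_⟩
  exact Finset.single_le_sum (f := M) (fun i _ => (hM i).nonneg) (Finset.mem_univ i)

lemma key_est {a b : ℝ} (hab : a < b) (n : ℕ) {α : ℝ} (hα1 : α ≤ 1) (m r : ℕ)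
    (A0 : Fin r → ℝ → Matrix (Fin m) (Fin m) ℂ) (hA0 : ∀ j, mHolMem a b n α (A0 j)) :
    ∃ C : ℝ, 0 ≤ C ∧ ∀ (A1 : Fin r → ℝ → Matrix (Fin m) (Fin m) ℂ)
      (y : Fin r → Fin m → ℝ → (Fin m → ℂ)) (δ S : ℝ),
      (∀ j p q, Gd a b n α (fun t => A1 j t p q - A0 j t p q) S) →
      (∀ k i p, Gd a b (n + r) α (fun t => y k i t p - yTest r m k i t p) δ) →
      (∀ k i, ∀ t ∈ Icc a b, Lop a b r A1 (y k i) t = Lop a b r A0 (yTest r m k i) t) →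
      ∀ j p q, Gd a b n α (fun t => A1 j t p q - A0 j t p q) (C * (δ * (1 + S))) := by
  obtain ⟨M0, hM0, hA⟩ := exists_common
    (fun (z : Fin r × Fin m × Fin m) t => A0 z.1 t z.2.1 z.2.2)
    (fun z => ⟨_, HolMem.gd hab hα1 (hA0 z.1 z.2.1 z.2.2)⟩)
  obtain ⟨Me, hMe, hexp⟩ := exists_common (a := a) (b := b) (n := n) (α := α)
    (fun (k : Fin r) (t : ℝ) => Complex.exp ((-((k : ℕ) : ℂ)) * t))
    (fun k => smooth_gd hab n hα1 (exp_cd _ _).contDiffOn)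
  set V : Matrix (Fin r) (Fin r) ℂ := Matrix.vandermonde (fun k : Fin r => ((k : ℕ) : ℂ)) with hV
  have hdet : IsUnit V.det := by
    rw [isUnit_iff_ne_zero, hV, Matrix.det_vandermonde_ne_zero_iff]
    intro x y hxy
    simpa [Fin.ext_iff] using hxy
  have hinv : V⁻¹ * V = 1 := Matrix.nonsing_inv_mul V hdet
  set c : ℝ := r * (m * 2 ^ (n + 1)) with hc
  have hc0 : 0 ≤ c := by positivity
  set C1 : ℝ := 1 + c * M0 + c with hC1
  have hC10 : 0 ≤ C1 := by positivity
  set W : ℝ := ∑ l : Fin r, ∑ k : Fin r, ‖V⁻¹ l k‖ with hW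
  have hW0 : 0 ≤ W := by positivity
  refine ⟨W * (2 ^ (n + 1) * Me * C1), by positivity, ?_⟩
  intro A1 y δ S hD hE heq l p i
  have hr : 0 < r := l.pos
  have hδ : 0 ≤ δ := (hE l i p).nonneg
  have hS : 0 ≤ S := (hD l p i).nonneg
  have hG : ∀ k : Fin r, Gd a b n α (fun t => ∑ j : Fin r,
      (((k : ℕ) : ℂ) ^ (j : ℕ) * Complex.exp (((k : ℕ) : ℂ) * t)) *
        (A1 j t p i - A0 j t p i)) (C1 * (δ * (1 + S))) := by
    intro k
    have g1 := ((hE k i p).deriv hab (le_refl r)).smul (-1)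
    have g2 := (Gd.sum hab Finset.univ fun j _ => Gd.sum hab Finset.univ fun q _ =>
      (hA (j, p, q)).mul hab ((hE k i q).deriv hab (j := (j : Fin r)) j.2.le)).smul (-1)
    have g3 := (Gd.sum hab Finset.univ fun j _ => Gd.sum hab Finset.univ fun q _ =>
      (hD j p q).mul hab ((hE k i q).deriv hab (j := (j : Fin r)) j.2.le)).smul (-1)
    refine ((g1.add hab (g2.add hab g3)).congr fun t ht =>
      key_identity hab n m r A0 A1 k i p (y k i) (fun q => (hE k i q).cd) t ht
        (heq k i t ht)).mono ?_
    simp only [norm_neg, norm_one, one_mul, Finset.sum_const, Finset.card_univ,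
      Fintype.card_fin, nsmul_eq_mul]
    have : C1 * (δ * (1 + S)) - (δ + (r * (m * (2 ^ (n + 1) * M0 * δ)) +
        r * (m * (2 ^ (n + 1) * S * δ)))) = δ * (c + (1 + c * M0) * S) := by
      rw [hC1, hc]; ring
    have : 0 ≤ δ * (c + (1 + c * M0) * S) := by positivity
    linarith
  have hfin := Gd.sum hab Finset.univ fun k _ => (((hexp k).mul hab (hG k)).smul (V⁻¹ l k))
  refine (hfin.congr fun t ht => ?_).mono ?_
  · have h1 : ∀ k : Fin r, Complex.exp ((-((k : ℕ) : ℂ)) * t) * (∑ j : Fin r,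
        (((k : ℕ) : ℂ) ^ (j : ℕ) * Complex.exp (((k : ℕ) : ℂ) * t)) *
        (A1 j t p i - A0 j t p i)) = ∑ j, V k j * (A1 j t p i - A0 j t p i) := by
      intro k
      rw [Finset.mul_sum]
      refine Finset.sum_congr rfl fun j _ => ?_
      have : Complex.exp ((-((k : ℕ) : ℂ)) * t) * Complex.exp (((k : ℕ) : ℂ) * t) = 1 := by
        rw [← Complex.exp_add]; simp
      rw [hV, Matrix.vandermonde_apply]
      linear_combination (((k : ℕ) : ℂ) ^ (j : ℕ) * (A1 j t p i - A0 j t p i)) * this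
    simp_rw [h1]
    have h2 : ∑ k, V⁻¹ l k * ∑ j, V k j * (A1 j t p i - A0 j t p i) =
        ((V⁻¹ * V).mulVec (fun j => A1 j t p i - A0 j t p i)) l := by
      rw [← Matrix.mulVec_mulVec]; rfl
    rw [h2, hinv]; simp
  · rw [← Finset.sum_mul]
    have : ∑ k, ‖V⁻¹ l k‖ ≤ W := Finset.single_le_sum (f := fun l => ∑ k, ‖V⁻¹ l k‖)
      (fun l _ => by positivity) (Finset.mem_univ l)
    calc _ ≤ W * (2 ^ (n + 1) * Me * (C1 * (δ * (1 + S)))) := by gcongr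
      _ = _ := by ring

lemma gd_sub {a b : ℝ} (hab : a < b) {n : ℕ} {α : ℝ} {x y : ℝ → ℂ} {M N : ℝ}
    (hx : Gd a b n α x M) (hy : Gd a b n α y N) :
    Gd a b n α (fun t => x t - y t) (M + N) := by
  have := hx.add hab (hy.smul (-1))
  simp only [norm_neg, norm_one, one_mul] at this
  exact this.congr fun t _ => by ring

lemma Lop_yTest_mem {a b : ℝ} (hab : a < b) (n : ℕ) {α : ℝ} (hα1 : α ≤ 1) (m r : ℕ)
    (A0 : Fin r → ℝ → Matrix (Fin m) (Fin m) ℂ) (hA0 : ∀ j, mHolMem a b n α (A0 j))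
    (k : Fin r) (i : Fin m) : vHolMem a b n α (Lop a b r A0 (yTest r m k i)) := by
  intro p
  have hy : ∀ q, ∃ M, Gd a b (n + r) α (fun t => yTest r m k i t q) M := fun q =>
    smooth_gd hab (n + r) hα1 (yTest_cd r m k i q _).contDiffOn
  choose M hM using hy
  have h := ((hM p).deriv hab (le_refl r)).add hab (Gd.sum hab Finset.univ fun j _ =>
    Gd.sum hab Finset.univ fun q _ => (HolMem.gd hab hα1 (hA0 j p q)).mul hab
      ((hM q).deriv hab (j := (j : Fin r)) j.2.le))
  exact (h.congr fun t ht => Lop_apply a b r A0 (yTest r m k i) t p).holMem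

lemma vHolNorm_nonneg' (a b : ℝ) (n : ℕ) (α : ℝ) {k : ℕ} (x : ℝ → (Fin k → ℂ)) :
    0 ≤ vHolNorm a b n α x := Finset.sum_nonneg fun _ _ => holNorm_nonneg' _ _ _ _ _

lemma mHolNorm_nonneg' (a b : ℝ) (n : ℕ) (α : ℝ) {k l : ℕ}
    (x : ℝ → Matrix (Fin k) (Fin l) ℂ) : 0 ≤ mHolNorm a b n α x :=
  Finset.sum_nonneg fun _ _ => Finset.sum_nonneg fun _ _ => holNorm_nonneg' _ _ _ _ _

lemma holNorm_le_v (a b : ℝ) (n : ℕ) (α : ℝ) {k : ℕ} (x : ℝ → (Fin k → ℂ)) (i : Fin k) :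
    holNorm a b n α (fun t => x t i) ≤ vHolNorm a b n α x :=
  Finset.single_le_sum (f := fun i => holNorm a b n α (fun t => x t i))
    (fun _ _ => holNorm_nonneg' _ _ _ _ _) (Finset.mem_univ i)

lemma holNorm_le_m (a b : ℝ) (n : ℕ) (α : ℝ) {k l : ℕ} (x : ℝ → Matrix (Fin k) (Fin l) ℂ)
    (i : Fin k) (j : Fin l) :
    holNorm a b n α (fun t => x t i j) ≤ mHolNorm a b n α x :=
  (Finset.single_le_sum (f := fun j => holNorm a b n α (fun t => x t i j))
    (fun _ _ => holNorm_nonneg' _ _ _ _ _) (Finset.mem_univ j)).trans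
  (Finset.single_le_sum (f := fun i => ∑ j, holNorm a b n α (fun t => x t i j))
    (fun _ _ => Finset.sum_nonneg fun _ _ => holNorm_nonneg' _ _ _ _ _) (Finset.mem_univ i))

lemma sol_family {a b : ℝ} (hab : a < b) (n : ℕ) {α : ℝ} (hα1 : α ≤ 1) (m r : ℕ)
    (A : ℝ → Fin r → ℝ → Matrix (Fin m) (Fin m) ℂ)
    (hA0 : ∀ j, mHolMem a b n α (A 0 j))
    (B : ℝ → (ℝ → (Fin m → ℂ)) →ₗ[ℂ] (Fin (r * m) → ℂ))
    (ε₁ : ℝ)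
    (hstar : CondStar a b n α r m ε₁ A B)
    (hstarstar : CondStarStar a b n α r m ε₁ A B) (k : Fin r) (i : Fin m) :
    ∃ y : ℝ → ℝ → (Fin m → ℂ),
      (∀ ε ∈ Ico (0 : ℝ) ε₁, vHolMem a b (n + r) α (y ε) ∧
        ∀ t ∈ Icc a b, Lop a b r (A ε) (y ε) t = Lop a b r (A 0) (yTest r m k i) t) ∧
      Tendsto (fun ε => vHolNorm a b (n + r) α (fun t => y ε t - yTest r m k i t))
        (nhdsWithin 0 (Ioi 0)) (nhds 0) := by
  classical
  have hF := Lop_yTest_mem hab n hα1 m r (A 0) hA0 k i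
  have hex : ∀ ε : ℝ, ∃ y : ℝ → (Fin m → ℂ), ε ∈ Ico (0 : ℝ) ε₁ →
      IsSol a b n α r m (A ε) (B ε) (Lop a b r (A 0) (yTest r m k i))
        (B 0 (yTest r m k i)) y := by
    intro ε
    by_cases h : ε ∈ Ico (0 : ℝ) ε₁
    · obtain ⟨y, hy, _⟩ := hstar ε h _ hF (B 0 (yTest r m k i))
      exact ⟨y, fun _ => hy⟩
    · exact ⟨0, fun h' => absurd h' h⟩
  choose z hz using hex
  have h0 : IsSol a b n α r m (A 0) (B 0) (Lop a b r (A 0) (yTest r m k i))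
        (B 0 (yTest r m k i)) (yTest r m k i) := by
    refine ⟨fun q => ?_, fun t _ => rfl, rfl⟩
    obtain ⟨M, hM⟩ := smooth_gd hab (n + r) hα1 (yTest_cd r m k i q _).contDiffOn
    exact hM.holMem
  set y : ℝ → ℝ → (Fin m → ℂ) := fun ε => if ε = 0 then yTest r m k i else z ε with hy
  have hy0 : y 0 = yTest r m k i := by simp [hy]
  have hsol : ∀ ε ∈ Ico (0 : ℝ) ε₁, IsSol a b n α r m (A ε) (B ε)
      (Lop a b r (A 0) (yTest r m k i)) (B 0 (yTest r m k i)) (y ε) := by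
    intro ε hε
    by_cases h : ε = 0
    · subst h; rw [hy0]; exact h0
    · simp only [hy, h, if_false]; exact hz ε hε
  refine ⟨y, fun ε hε => ⟨(hsol ε hε).1, (hsol ε hε).2.1⟩, ?_⟩
  rw [← hy0]
  refine hstarstar (fun _ => Lop a b r (A 0) (yTest r m k i)) (fun _ => B 0 (yTest r m k i)) y
    (fun ε hε => ⟨hF, hsol ε hε⟩) ?_ tendsto_const_nhds
  have : vHolNorm a b n α (fun t => Lop a b r (A 0) (yTest r m k i) t -
      Lop a b r (A 0) (yTest r m k i) t) = 0 := by
    refine Finset.sum_eq_zero fun p _ => le_antisymm ?_ (holNorm_nonneg' _ _ _ _ _)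
    have := (Gd.zero a b n α).holNorm_le
    simpa using this
  rw [this]
  exact tendsto_const_nhds

/-- If the solution depends continuously on ε at ε = 0 (conditions (∗) and (∗∗)), then
Limit Condition (I) holds; in particular the Hölder norms of the coefficient matrices
are O(1) as ε → 0+. -/
theorem continuous_dependence_implies_condI
    (a b : ℝ) (hab : a < b) (n : ℕ) (α : ℝ) (hα0 : 0 < α) (hα1 : α ≤ 1)
    (m r : ℕ) (hm : 1 ≤ m) (hr : 2 ≤ r) (ε₀ : ℝ) (hε₀ : 0 < ε₀)
    (A : ℝ → Fin r → ℝ → Matrix (Fin m) (Fin m) ℂ)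
    (hA : ∀ ε ∈ Set.Ico (0 : ℝ) ε₀, ∀ j, mHolMem a b n α (A ε j))
    (B : ℝ → (ℝ → (Fin m → ℂ)) →ₗ[ℂ] (Fin (r * m) → ℂ))
    (hB : ∀ ε ∈ Set.Ico (0 : ℝ) ε₀, ∃ K : ℝ, ∀ y : ℝ → (Fin m → ℂ),
      vHolMem a b (n + r) α y → ‖B ε y‖ ≤ K * vHolNorm a b (n + r) α y)
    (ε₁ : ℝ) (hε₁0 : 0 < ε₁) (hε₁ : ε₁ < ε₀)
    (hstar : CondStar a b n α r m ε₁ A B)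
    (hstarstar : CondStarStar a b n α r m ε₁ A B) :
    CondI a b n α r m A ∧
      ∀ j : Fin r, ∃ K ε' : ℝ, 0 < ε' ∧ ε' < ε₀ ∧
        ∀ ε ∈ Set.Ioo (0 : ℝ) ε', mHolNorm a b n α (A ε j) ≤ K := by
  have h0mem : (0 : ℝ) ∈ Ico (0 : ℝ) ε₀ := ⟨le_rfl, hε₀⟩
  have hA0 := hA 0 h0mem
  have hK := KK_pos (α := α) hab
  obtain ⟨C, hC0, hC⟩ := key_est hab n hα1 m r (A 0) hA0
  choose y hy hylim using sol_family hab n hα1 m r A hA0 B ε₁ hstar hstarstar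
  set S : ℝ → ℝ := fun ε => ∑ j, mHolNorm a b n α (fun t => A ε j t - A 0 j t) with hSdef
  set T : ℝ → ℝ := fun ε => ∑ k, ∑ i,
    vHolNorm a b (n + r) α (fun t => y k i ε t - yTest r m k i t) with hTdef
  have hTlim : Tendsto T (nhdsWithin 0 (Ioi 0)) (nhds 0) := by
    have := tendsto_finsetSum Finset.univ fun k _ =>
      tendsto_finsetSum Finset.univ fun i _ => hylim k i
    simpa using this
  have hS0 : ∀ ε, 0 ≤ S ε := fun ε => Finset.sum_nonneg fun _ _ => mHolNorm_nonneg' _ _ _ _ _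
  have hSj : ∀ ε j, mHolNorm a b n α (fun t => A ε j t - A 0 j t) ≤ S ε := fun ε j =>
    Finset.single_le_sum (f := fun j => mHolNorm a b n α (fun t => A ε j t - A 0 j t))
      (fun _ _ => mHolNorm_nonneg' _ _ _ _ _) (Finset.mem_univ j)
  have hD : ∀ ε ∈ Ico (0 : ℝ) ε₁, ∀ j p q,
      Gd a b n α (fun t => A ε j t p q - A 0 j t p q) (KK a b α * S ε) := by
    intro ε hε j p q
    have hm : HolMem a b n α (fun t => A ε j t p q - A 0 j t p q) :=
      (gd_sub hab (HolMem.gd hab hα1 (hA ε ⟨hε.1, hε.2.trans hε₁⟩ j p q))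
        (HolMem.gd hab hα1 (hA0 j p q))).holMem
    refine (HolMem.gd hab hα1 hm).mono (mul_le_mul_of_nonneg_left ?_ (by linarith))
    exact (holNorm_le_m a b n α (fun t => A ε j t - A 0 j t) p q).trans (hSj ε j)
  have hE : ∀ ε ∈ Ico (0 : ℝ) ε₁, ∀ k i p,
      Gd a b (n + r) α (fun t => y k i ε t p - yTest r m k i t p) (KK a b α * T ε) := by
    intro ε hε k i p
    obtain ⟨M, hM⟩ := smooth_gd hab (n + r) hα1 (yTest_cd r m k i p _).contDiffOn
    have hm : HolMem a b (n + r) α (fun t => y k i ε t p - yTest r m k i t p) :=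
      (gd_sub hab (HolMem.gd hab hα1 ((hy k i ε hε).1 p)) hM).holMem
    refine (HolMem.gd hab hα1 hm).mono (mul_le_mul_of_nonneg_left ?_ (by linarith))
    refine (holNorm_le_v a b (n + r) α (fun t => y k i ε t - yTest r m k i t) p).trans ?_
    exact (Finset.single_le_sum
      (f := fun i => vHolNorm a b (n + r) α (fun t => y k i ε t - yTest r m k i t))
      (fun _ _ => vHolNorm_nonneg' _ _ _ _ _) (Finset.mem_univ i)).trans
      (Finset.single_le_sum
      (f := fun k => ∑ i, vHolNorm a b (n + r) α (fun t => y k i ε t - yTest r m k i t))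
      (fun _ _ => Finset.sum_nonneg fun _ _ => vHolNorm_nonneg' _ _ _ _ _) (Finset.mem_univ k))
  set Q : ℝ := r * (m * (m * ((n + 2) * C))) * KK a b α with hQ
  have hmain : ∀ ε ∈ Ico (0 : ℝ) ε₁, S ε ≤ Q * T ε + Q * KK a b α * T ε * S ε := by
    intro ε hε
    have h := hC (A ε) (fun k i => y k i ε) _ _ (hD ε hε) (hE ε hε)
      (fun k i => (hy k i ε hε).2)
    calc S ε ≤ ∑ j : Fin r, ∑ p : Fin m, ∑ q : Fin m,
          (n + 2) * (C * (KK a b α * T ε * (1 + KK a b α * S ε))) :=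
          Finset.sum_le_sum fun j _ => Finset.sum_le_sum fun p _ => Finset.sum_le_sum fun q _ =>
            (h j p q).holNorm_le
      _ = _ := by
          simp only [Finset.sum_const, Finset.card_univ, Fintype.card_fin, nsmul_eq_mul]
          rw [hQ]; ring
  have hIco : ∀ᶠ ε in nhdsWithin (0 : ℝ) (Ioi 0), ε ∈ Ico (0 : ℝ) ε₁ := by
    filter_upwards [Ioo_mem_nhdsGT hε₁0] with ε hε
    exact ⟨hε.1.le, hε.2⟩
  have hsmall : ∀ᶠ ε in nhdsWithin (0 : ℝ) (Ioi 0), Q * KK a b α * T ε < 1 / 2 := by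
    have : Tendsto (fun ε => Q * KK a b α * T ε) (nhdsWithin 0 (Ioi 0)) (nhds 0) := by
      simpa using hTlim.const_mul (Q * KK a b α)
    exact this.eventually (gt_mem_nhds (by norm_num))
  have hSlim : Tendsto S (nhdsWithin 0 (Ioi 0)) (nhds 0) := by
    have h2 : Tendsto (fun ε => 2 * Q * T ε) (nhdsWithin 0 (Ioi 0)) (nhds 0) := by
      simpa using hTlim.const_mul (2 * Q)
    refine tendsto_of_tendsto_of_tendsto_of_le_of_le' tendsto_const_nhds h2
      (Eventually.of_forall hS0) ?_
    filter_upwards [hIco, hsmall] with ε h1 h3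
    have h4 := hmain ε h1
    have h5 := mul_le_mul_of_nonneg_right h3.le (hS0 ε)
    linarith
  refine ⟨fun j => squeeze_zero (fun ε => mHolNorm_nonneg' _ _ _ _ _) (fun ε => hSj ε j) hSlim,
    fun j => ?_⟩
  have hS1 : ∀ᶠ ε in nhdsWithin (0 : ℝ) (Ioi 0), S ε < 1 :=
    hSlim.eventually (gt_mem_nhds (by norm_num))
  obtain ⟨u, hu0, hu⟩ := mem_nhdsGT_iff_exists_Ioo_subset.1 hS1
  obtain ⟨M0, hM0, hA'⟩ := exists_common
    (fun (z : Fin m × Fin m) t => A 0 j t z.1 z.2)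
    (fun z => ⟨_, HolMem.gd hab hα1 (hA0 j z.1 z.2)⟩)
  refine ⟨∑ p : Fin m, ∑ q : Fin m, (n + 2) * (KK a b α * 1 + M0), min u ε₁,
    lt_min hu0 hε₁0, (min_le_right _ _).trans_lt hε₁, ?_⟩
  intro ε hε
  have hεu : ε ∈ Ioo 0 u := ⟨hε.1, hε.2.trans_le (min_le_left _ _)⟩
  have hεI : ε ∈ Ico 0 ε₁ := ⟨hε.1.le, hε.2.trans_le (min_le_right _ _)⟩
  have hS1' : S ε < 1 := hu hεu
  refine Finset.sum_le_sum fun p _ => Finset.sum_le_sum fun q _ => ?_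
  have g1 := (hD ε hεI j p q).mono (mul_le_mul_of_nonneg_left hS1'.le (by linarith))
  have g2 := g1.add hab (hA' (p, q))
  exact (g2.congr fun t _ => by ring).holNorm_le
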